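/- arXiv:1810.03030 — 2 statements merged into one kernel-verified Lean document; each statement's English description precedes it below -/
import Mathlib

section
/- Squared-weight G-computation identity: for every t ∈ {1, …, K+1} and every function f : L_0 × ⋯ × L_t → ℝ, E_p[ H^d_t(ā(t−1), l̄(t−1))² · f(l̄(t)) ] = Σ_{l̄(t)} P^d_t(l̄(t)) · f(l̄(t)) / g_{0:t−1}(d(l̄(t−1)), l̄(t−1)). -/
/-!
Longitudinal data structure `O = (L(0), A(0), …, A(K), L(K+1))` with full-support pmf `p`.
Histories are encoded by full trajectories together with agreement predicates on time prefixes;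
a sum over histories `l̄(t)` is encoded as a sum over full covariate trajectories whose
coordinates beyond `t` are pinned to an arbitrary base point `l₀` (`tailEq`).
-/

open Finset
open scoped Classical

noncomputable section

variable {K : ℕ} {L : Fin (K + 2) → Type} {A : Fin (K + 1) → Type}

/-- Covariate trajectories. -/
abbrev Traj (K : ℕ) (L : Fin (K + 2) → Type) : Type := ∀ s : Fin (K + 2), L s

/-- Treatment trajectories. -/
abbrev Trt (K : ℕ) (A : Fin (K + 1) → Type) : Type := ∀ s : Fin (K + 1), A s

/-- Observations. -/
abbrev Obs (K : ℕ) (L : Fin (K + 2) → Type) (A : Fin (K + 1) → Type) : Type :=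
  Traj K L × Trt K A

/-- Agreement of covariate trajectories on time indices `< t` (i.e. they share `l̄(t-1)`). -/
def aL (t : ℕ) (l l' : Traj K L) : Prop := ∀ s : Fin (K + 2), (s : ℕ) < t → l s = l' s

/-- Agreement of treatment trajectories on time indices `< t` (i.e. they share `ā(t-1)`). -/
def aA (t : ℕ) (a a' : Trt K A) : Prop := ∀ s : Fin (K + 1), (s : ℕ) < t → a s = a' s

variable [∀ t, Fintype (L t)] [∀ t, Fintype (A t)]

/-- Mass of the event that the covariates agree with `l` on indices `< tL` and the treatments
agree with `a` on indices `< tA`. -/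
def marg (p : Obs K L A → ℝ) (tL tA : ℕ) (l : Traj K L) (a : Trt K A) : ℝ :=
  ∑ o' : Obs K L A, if aL tL l o'.1 ∧ aA tA a o'.2 then p o' else 0

/-- The conditional factor `q_t(l_t ∣ l̄(t-1), ā(t-1))`. -/
def qC (p : Obs K L A → ℝ) (t : ℕ) (l : Traj K L) (a : Trt K A) : ℝ :=
  marg p (t + 1) t l a / marg p t t l a

/-- The treatment mechanism factor `g_t(a_t ∣ l̄(t), ā(t-1))`. -/
def gC (p : Obs K L A → ℝ) (t : ℕ) (l : Traj K L) (a : Trt K A) : ℝ :=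
  marg p (t + 1) (t + 1) l a / marg p (t + 1) t l a

/-- The cumulative treatment probability `g_{0:t-1}(ā(t-1), l̄(t-1))`; in particular
`gCum p 0 = 1` is the convention `g_{0:-1} = 1`. -/
def gCum (p : Obs K L A → ℝ) (t : ℕ) (l : Traj K L) (a : Trt K A) : ℝ :=
  ∏ m ∈ Finset.range t, gC p m l a

/-- The treatment trajectory determined by the regimen `d` along the covariates `l`. -/
def aOf (d : ∀ t : Fin (K + 1), Traj K L → A t) (l : Traj K L) : Trt K A := fun s => d s l

/-- A regimen is adapted: `d_t` depends only on `l̄(t)`. -/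
def Adapted (d : ∀ t : Fin (K + 1), Traj K L → A t) : Prop :=
  ∀ t : Fin (K + 1), ∀ l l' : Traj K L, aL ((t : ℕ) + 1) l l' → d t l = d t l'

/-- The event `ā(t-1) = d(l̄(t-1))`. -/
def follows (d : ∀ t : Fin (K + 1), Traj K L → A t) (t : ℕ) (o : Obs K L A) : Prop :=
  ∀ s : Fin (K + 1), (s : ℕ) < t → o.2 s = d s o.1

/-- The inverse probability weight
`H^d_t(ā(t-1), l̄(t-1)) = 1{ā(t-1) = d(l̄(t-1))} / g_{0:t-1}`; `Hd p d 0 = 1`. -/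
def Hd (p : Obs K L A → ℝ) (d : ∀ t : Fin (K + 1), Traj K L → A t) (t : ℕ)
    (o : Obs K L A) : ℝ :=
  (if follows d t o then (1 : ℝ) else 0) / gCum p t o.1 o.2

/-- The sequential regression `Q̄^d_t(l̄(t-1))`, defined downward from
`Q̄^d_{K+2}(l̄(K+1)) = y(l_{K+1})` by
`Q̄^d_t(l̄(t-1)) = Σ_{l_t} q_t(l_t ∣ l̄(t-1), d(l̄(t-1))) Q̄^d_{t+1}(l̄(t))`. -/
def Qbar (p : Obs K L A → ℝ) (y : L (Fin.last (K + 1)) → ℝ)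
    (d : ∀ t : Fin (K + 1), Traj K L → A t) (t : ℕ) (l : Traj K L) : ℝ :=
  if ht : t < K + 2 then
    ∑ v : L ⟨t, ht⟩,
      qC p t (Function.update l ⟨t, ht⟩ v) (aOf d (Function.update l ⟨t, ht⟩ v)) *
        Qbar p y d (t + 1) (Function.update l ⟨t, ht⟩ v)
  else y (l (Fin.last (K + 1)))
termination_by K + 2 - t
decreasing_by omega

/-- The G-computation mass `P^d_t(l̄(t)) = Π_{m=0}^{t} q_m(l_m ∣ l̄(m-1), d(l̄(m-1)))`. -/
def Pd (p : Obs K L A → ℝ) (d : ∀ t : Fin (K + 1), Traj K L → A t) (t : ℕ)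
    (l : Traj K L) : ℝ :=
  ∏ m ∈ Finset.range (t + 1), qC p m l (aOf d l)

/-- `l` agrees with the base point `l₀` on indices `> t`: summing a function of `l̄(t)` over
trajectories pinned to `l₀` beyond `t` realizes the sum over histories `l̄(t)`. -/
def tailEq (t : ℕ) (l₀ l : Traj K L) : Prop := ∀ s : Fin (K + 2), t < (s : ℕ) → l s = l₀ s

/-- The `t`-th component of the efficient influence function,
`D^{*,d}_t = H^d_t · (Q̄^d_{t+1} - Q̄^d_t)` (with `H^d_0 = 1`, so the `t = 0` component is
`Q̄^d_1(l_0) - Q̄^d_0`). -/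
def Dst (p : Obs K L A → ℝ) (y : L (Fin.last (K + 1)) → ℝ)
    (d : ∀ t : Fin (K + 1), Traj K L → A t) (t : ℕ) (o : Obs K L A) : ℝ :=
  Hd p d t o * (Qbar p y d (t + 1) o.1 - Qbar p y d t o.1)

theorem marg_congr (p : Obs K L A → ℝ) {tL tA : ℕ} {l l' : Traj K L} {a a' : Trt K A}
    (hl : aL tL l l') (ha : aA tA a a') : marg p tL tA l a = marg p tL tA l' a' := by
  unfold marg
  refine Finset.sum_congr rfl fun o _ => if_congr ?_ rfl rfl
  refine and_congr ⟨fun h s hs => ?_, fun h s hs => ?_⟩ ⟨fun h s hs => ?_, fun h s hs => ?_⟩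
  · rw [← hl s hs, h s hs]
  · rw [hl s hs, h s hs]
  · rw [← ha s hs, h s hs]
  · rw [ha s hs, h s hs]

theorem gCum_congr (p : Obs K L A → ℝ) {t : ℕ} {l l' : Traj K L} {a a' : Trt K A}
    (hl : aL t l l') (ha : aA t a a') : gCum p t l a = gCum p t l' a' := by
  unfold gCum gC
  refine Finset.prod_congr rfl fun m hm => ?_
  have hm : m < t := Finset.mem_range.1 hm
  rw [marg_congr p (fun s hs => hl s (by omega)) (fun s hs => ha s (by omega)),
    marg_congr p (fun s hs => hl s (by omega)) (fun s hs => ha s (by omega))]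

theorem marg_pos (p : Obs K L A → ℝ) (hp : ∀ o, 0 < p o) (tL tA : ℕ)
    (l : Traj K L) (a : Trt K A) : 0 < marg p tL tA l a := by
  refine Finset.sum_pos' (fun o _ => ?_) ⟨(l, a), Finset.mem_univ _, ?_⟩
  · split_ifs
    exacts [(hp o).le, le_rfl]
  · rw [if_pos ⟨fun _ _ => rfl, fun _ _ => rfl⟩]
    exact hp _

theorem gCum_pos (p : Obs K L A → ℝ) (hp : ∀ o, 0 < p o) (t : ℕ)
    (l : Traj K L) (a : Trt K A) : 0 < gCum p t l a :=
  Finset.prod_pos fun _ _ => div_pos (marg_pos p hp _ _ l a) (marg_pos p hp _ _ l a)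

/-- The chain rule: the joint mass of `(l̄(t), d(l̄(t-1)))` factorizes into the covariate and
treatment conditionals. -/
theorem Pd_mul_gCum (p : Obs K L A → ℝ) (hp : ∀ o, 0 < p o) (hp1 : ∑ o : Obs K L A, p o = 1)
    (d : ∀ t : Fin (K + 1), Traj K L → A t) (t : ℕ) (l : Traj K L) :
    Pd p d t l * gCum p t l (aOf d l) = marg p (t + 1) t l (aOf d l) := by
  induction t with
  | zero =>
    have h0 : marg p 0 0 l (aOf d l) = 1 := by simp [marg, aL, aA, hp1]
    simp [Pd, gCum, qC, h0]
  | succ t ih =>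
    have h1 := (marg_pos p hp (t + 1) t l (aOf d l)).ne'
    have h2 := (marg_pos p hp (t + 1) (t + 1) l (aOf d l)).ne'
    have hP : Pd p d (t + 1) l = Pd p d t l * qC p (t + 1) l (aOf d l) :=
      Finset.prod_range_succ _ _
    have hG : gCum p (t + 1) l (aOf d l) = gCum p t l (aOf d l) * gC p t l (aOf d l) :=
      Finset.prod_range_succ _ _
    rw [hP, hG, mul_mul_mul_comm, ih, qC, gC]
    field_simp

/-- Given the covariate history `l̄(t)`, following an adapted regimen up to time `t - 1` means
that the treatments agree with those the regimen assigns along `l`. -/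
theorem follows_iff_aA {d : ∀ t : Fin (K + 1), Traj K L → A t} (hd : Adapted d) {t : ℕ}
    {l : Traj K L} {o : Obs K L A} (hl : aL (t + 1) l o.1) :
    follows d t o ↔ aA t (aOf d l) o.2 := by
  refine forall₂_congr fun s hs => ?_
  rw [← hd s l o.1 fun r hr => hl r (by omega)]
  exact eq_comm

/-- Summing over trajectories with a fixed tail selects the unique one sharing the history. -/
theorem sum_tailEq_aL (t : ℕ) (l₀ l' : Traj K L) (F : Traj K L → ℝ) (c : ℝ)
    (hF : ∀ l, aL (t + 1) l l' → F l = c) :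
    ∑ l : Traj K L, (if tailEq t l₀ l then if aL (t + 1) l l' then F l else 0 else 0) = c := by
  set l₁ : Traj K L := fun s => if (s : ℕ) < t + 1 then l' s else l₀ s
  have h1 : aL (t + 1) l₁ l' := fun s hs => if_pos hs
  have h2 : tailEq t l₀ l₁ := fun s hs => if_neg (by omega)
  rw [Finset.sum_eq_single l₁, if_pos h2, if_pos h1, hF _ h1]
  · intro l _ hne
    split_ifs with h3 h4
    · refine absurd (funext fun s => ?_) hne
      by_cases hs : (s : ℕ) < t + 1
      · rw [h4 s hs, h1 s hs]
      · rw [h3 s (by omega), h2 s (by omega)]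
    all_goals rfl
  · exact fun h => absurd (Finset.mem_univ _) h

/-- squared-weight G-computation identity
`E_p[(H^d_t)² · f(l̄(t))] = Σ_{l̄(t)} P^d_t(l̄(t)) f(l̄(t)) / g_{0:t-1}(d(l̄(t-1)), l̄(t-1))`. -/
theorem sq_ipw_gcomp_identity [∀ t, Nonempty (L t)] [∀ t, Nonempty (A t)]
    (p : Obs K L A → ℝ) (hp : ∀ o, 0 < p o) (hp1 : ∑ o : Obs K L A, p o = 1)
    (d : ∀ t : Fin (K + 1), Traj K L → A t) (hd : Adapted d)
    (t : ℕ) (ht1 : 1 ≤ t) (ht2 : t ≤ K + 1)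
    (f : Traj K L → ℝ) (hf : ∀ l l' : Traj K L, aL (t + 1) l l' → f l = f l')
    (l₀ : Traj K L) :
    ∑ o : Obs K L A, p o * (Hd p d t o ^ 2 * f o.1)
      = ∑ l : Traj K L,
          if tailEq t l₀ l then Pd p d t l * f l / gCum p t l (aOf d l) else 0 := by
  have key : ∀ o : Obs K L A, p o * (Hd p d t o ^ 2 * f o.1)
      = ∑ l : Traj K L, (if tailEq t l₀ l then if aL (t + 1) l o.1 then
          (if aA t (aOf d l) o.2 then p o else 0) * (f l / gCum p t l (aOf d l) ^ 2)
          else 0 else 0) := by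
    intro o
    refine (sum_tailEq_aL t l₀ o.1 _ _ fun l hl => ?_).symm
    rw [hf l o.1 hl, Hd]
    by_cases h : follows d t o
    · have h' := (follows_iff_aA hd hl).1 h
      rw [if_pos h', if_pos h, gCum_congr p (fun s hs => hl s (by omega)) h']
      ring
    · rw [if_neg h, if_neg (fun h' => h ((follows_iff_aA hd hl).2 h'))]
      ring
  rw [Finset.sum_congr rfl fun o _ => key o, Finset.sum_comm]
  refine Finset.sum_congr rfl fun l _ => ?_
  by_cases hl : tailEq t l₀ l
  · simp only [if_pos hl]
    have hG := (gCum_pos p hp t l (aOf d l)).ne'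
    trans marg p (t + 1) t l (aOf d l) * (f l / gCum p t l (aOf d l) ^ 2)
    · rw [marg, Finset.sum_mul]
      refine Finset.sum_congr rfl fun o _ => ?_
      by_cases h : aL (t + 1) l o.1 <;> simp [h]
    · rw [← Pd_mul_gCum p hp hp1]
      field_simp
  · simp [hl]

end
end

section
/- Sequential regression (iterated conditional expectation) representation of the G-computation mean: fix t ∈ {0, …, K+1} and Z : L_0 × ⋯ × L_t → ℝ. Define R_t = Z and, recursively for m = t down to 1, R_{m−1}(l̄(m−1)) = Σ_{l_m} q_m(l_m | l̄(m−1), d(l̄(m−1))) R_m(l̄(m)), and finally R_{−1} = Σ_{l_0} q_0(l_0) R_0(l_0). Then R_{−1} = E_{P^d}[ Z(l̄(t)) ] = Σ_{l̄(t)} P^d_t(l̄(t)) Z(l̄(t)). -/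
/-!
Longitudinal data structure `O = (L(0), A(0), …, A(K), L(K+1))` with full-support pmf `p`.
Histories are encoded by full trajectories together with agreement predicates on time prefixes;
a sum over histories `l̄(t)` is encoded as a sum over full covariate trajectories whose
coordinates beyond `t` are pinned to an arbitrary base point `l₀` (`tailEq`).
-/

open Finset
open scoped Classical

noncomputable section

variable {K : ℕ} {L : Fin (K + 2) → Type} {A : Fin (K + 1) → Type}

variable [∀ t, Fintype (L t)] [∀ t, Fintype (A t)]

omit [∀ t, Fintype (L t)] in
theorem aL.mono {s t : ℕ} (hst : s ≤ t) {l l' : Traj K L} (h : aL t l l') : aL s l l' :=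
  fun i hi => h i (hi.trans_le hst)

omit [∀ t, Fintype (L t)] in
theorem aL_congr {t : ℕ} {l l' : Traj K L} (h : aL t l l') (x : Traj K L) :
    aL t l x ↔ aL t l' x :=
  forall₂_congr fun s hs => by rw [h s hs]

omit [∀ t, Fintype (A t)] in
theorem aA_congr {t : ℕ} {a a' : Trt K A} (h : aA t a a') (x : Trt K A) :
    aA t a x ↔ aA t a' x :=
  forall₂_congr fun s hs => by rw [h s hs]

omit [∀ t, Fintype (L t)] in
theorem aL_update {n : ℕ} (hn : n < K + 2) (l : Traj K L) (v : L ⟨n, hn⟩) :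
    aL n (Function.update l ⟨n, hn⟩ v) l := fun _ hs =>
  Function.update_of_ne (fun h => hs.ne (congrArg Fin.val h)) v l

omit [∀ t, Fintype (L t)] [∀ t, Fintype (A t)] in
theorem Adapted.aA_aOf {d : ∀ t : Fin (K + 1), Traj K L → A t} (hd : Adapted d) {t : ℕ}
    {l l' : Traj K L} (h : aL t l l') : aA t (aOf d l) (aOf d l') :=
  fun s hs => hd s l l' (h.mono hs)

theorem qC_congr (p : Obs K L A → ℝ) {t : ℕ} {l l' : Traj K L} {a a' : Trt K A}
    (hl : aL (t + 1) l l') (ha : aA t a a') : qC p t l a = qC p t l' a' := by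
  rw [qC, qC, marg_congr p hl ha, marg_congr p (hl.mono t.le_succ) ha]

theorem Pd_congr (p : Obs K L A → ℝ) {d : ∀ t : Fin (K + 1), Traj K L → A t} (hd : Adapted d)
    {t : ℕ} {l l' : Traj K L} (h : aL (t + 1) l l') : Pd p d t l = Pd p d t l' := by
  refine Finset.prod_congr rfl fun m hm => ?_
  have hm : m < t + 1 := Finset.mem_range.mp hm
  exact qC_congr p (h.mono hm) (hd.aA_aOf (h.mono hm.le))

/-- Summing over trajectories pinned to `l₀` beyond `n` amounts to summing over those pinned from
`n` on, and then over the value at `n`. -/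
theorem sum_tailEq_eq_sum_update {n : ℕ} (hn : n < K + 2) (l₀ : Traj K L) (f : Traj K L → ℝ) :
    (∑ l : Traj K L, if tailEq n l₀ l then f l else 0) =
      ∑ l : Traj K L, if ∀ s : Fin (K + 2), n ≤ (s : ℕ) → l s = l₀ s then
        ∑ v : L ⟨n, hn⟩, f (Function.update l ⟨n, hn⟩ v) else 0 := by
  rw [← Finset.sum_filter, ← Finset.sum_filter, ← Finset.sum_product']
  refine Finset.sum_bij' (fun l _ => (Function.update l ⟨n, hn⟩ (l₀ ⟨n, hn⟩), l ⟨n, hn⟩))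
    (fun x _ => Function.update x.1 ⟨n, hn⟩ x.2) ?_ ?_ ?_ ?_ ?_
  · intro l hl
    simp only [Finset.mem_filter, Finset.mem_univ, true_and, Finset.mem_product,
      and_true] at hl ⊢
    intro s hs
    by_cases h : s = ⟨n, hn⟩
    · subst h
      simp
    · rw [Function.update_of_ne h]
      exact hl s (lt_of_le_of_ne hs fun h' => h (Fin.ext h'.symm))
  · rintro ⟨l, v⟩ hl
    simp only [Finset.mem_filter, Finset.mem_univ, true_and, Finset.mem_product,
      and_true] at hl ⊢
    intro s hs
    rw [Function.update_of_ne fun h => hs.ne' (congrArg Fin.val h)]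
    exact hl s hs.le
  · intro l _
    simp
  · rintro ⟨l, v⟩ hl
    simp only [Finset.mem_filter, Finset.mem_univ, true_and, Finset.mem_product, and_true] at hl
    simp [← hl ⟨n, hn⟩ le_rfl]
  · intro l _
    simp

/-- the sequential regression (iterated conditional expectation) `R_{-1}`,
obtained from `R_t = Z` by `R_{m-1}(l̄(m-1)) = Σ_{l_m} q_m(l_m ∣ l̄(m-1), d(l̄(m-1))) R_m(l̄(m))`
and finally `R_{-1} = Σ_{l_0} q_0(l_0) R_0(l_0)`, equals the G-computation mean
`Σ_{l̄(t)} P^d_t(l̄(t)) Z(l̄(t))`. -/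
theorem sequential_regression [∀ t, Nonempty (L t)] [∀ t, Nonempty (A t)]
    (p : Obs K L A → ℝ) (hp : ∀ o, 0 < p o) (hp1 : ∑ o : Obs K L A, p o = 1)
    (d : ∀ t : Fin (K + 1), Traj K L → A t) (hd : Adapted d)
    (t : ℕ) (ht : t ≤ K + 1)
    (Z : Traj K L → ℝ) (hZ : ∀ l l' : Traj K L, aL (t + 1) l l' → Z l = Z l')
    (R : ℕ → Traj K L → ℝ)
    (hRt : ∀ l : Traj K L, R t l = Z l)
    (hRrec : ∀ m, m < t → ∀ hm : m + 1 < K + 2, ∀ l : Traj K L,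
      R m l = ∑ v : L ⟨m + 1, hm⟩,
        qC p (m + 1) (Function.update l ⟨m + 1, hm⟩ v)
            (aOf d (Function.update l ⟨m + 1, hm⟩ v)) *
          R (m + 1) (Function.update l ⟨m + 1, hm⟩ v))
    (l₀ : Traj K L) (Rm1 : ℝ)
    (hRm1 : Rm1 = ∑ v : L ⟨0, by omega⟩,
      qC p 0 (Function.update l₀ ⟨0, by omega⟩ v)
          (aOf d (Function.update l₀ ⟨0, by omega⟩ v)) *
        R 0 (Function.update l₀ ⟨0, by omega⟩ v)) :
    Rm1 = ∑ l : Traj K L, if tailEq t l₀ l then Pd p d t l * Z l else 0 := by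
  have key : ∀ m ≤ t, Rm1 = ∑ l : Traj K L, if tailEq m l₀ l then Pd p d m l * R m l else 0 := by
    intro m
    induction m with
    | zero =>
      intro _
      have hpin (l : Traj K L) : (∀ s : Fin (K + 2), 0 ≤ (s : ℕ) → l s = l₀ s) ↔ l = l₀ := by
        simp [funext_iff]
      simp only [sum_tailEq_eq_sum_update (Nat.succ_pos (K + 1)), hpin, Finset.sum_ite_eq',
        Finset.mem_univ, if_true, hRm1, Pd, zero_add, Finset.prod_range_one]
    | succ m ih =>
      intro hm
      have hm' : m + 1 < K + 2 := by omega
      rw [ih (by omega), sum_tailEq_eq_sum_update hm']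
      refine Finset.sum_congr rfl fun l _ => if_congr Iff.rfl ?_ rfl
      rw [hRrec m hm hm', Finset.mul_sum]
      refine Finset.sum_congr rfl fun v _ => ?_
      rw [← Pd_congr p hd (aL_update hm' l v), ← mul_assoc, Pd, Pd, ← Finset.prod_range_succ]
  simpa only [hRt] using key t le_rfl

end
end
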